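/- There exists a constant C > 0 such that for every integer n ≥ 2 and every real y with |y| ≤ π, the difference between the two kernel integrals satisfies |∫_{-π}^{π} D_n(x+y) D_n(-x) dx − ∫_{-π}^{π} D̃_n(x+y) D̃_n(-x) dx| ≤ C · log n, i.e. the two integrals agree up to an error O(log n) uniformly in y. (This is Lemma A.1 of the paper.) -/

import Mathlib

open MeasureTheory Real

/-- The Dirichlet kernel `D_n(x) = sin(((n+1)/2)x)/sin(x/2)`, assigned the value `n+1`
by continuity at points where the denominator vanishes. -/
noncomputable def Dker (n : ℕ) (x : ℝ) : ℝ :=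
  if Real.sin (x / 2) = 0 then (n + 1 : ℝ)
  else Real.sin (((n : ℝ) + 1) / 2 * x) / Real.sin (x / 2)

/-- The modified kernel `D̃_n(x) = sin(((n+1)/2)x)/(x/2)`, assigned the value `n+1`
by continuity at `x = 0`. -/
noncomputable def Dtilde (n : ℕ) (x : ℝ) : ℝ :=
  if x = 0 then (n + 1 : ℝ)
  else Real.sin (((n : ℝ) + 1) / 2 * x) / (x / 2)

/-- An integrable majorant of the kernels, of height `n` and width `1 / n`. -/
noncomputable def peak (n : ℕ) (u : ℝ) : ℝ := (1 / (n : ℝ) + |u|)⁻¹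

lemma peak_denom_pos {n : ℕ} (hn : 2 ≤ n) (u : ℝ) : 0 < 1 / (n : ℝ) + |u| := by
  have : (0 : ℝ) < n := by exact_mod_cast (by omega : 0 < n)
  positivity

lemma peak_pos {n : ℕ} (hn : 2 ≤ n) (u : ℝ) : 0 < peak n u :=
  inv_pos.2 (peak_denom_pos hn u)

lemma peak_neg (n : ℕ) (u : ℝ) : peak n (-u) = peak n u := by simp [peak]

lemma continuous_peak {n : ℕ} (hn : 2 ≤ n) : Continuous (peak n) := by
  unfold peak
  exact Continuous.inv₀ (by fun_prop) fun u => (peak_denom_pos hn u).ne'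

lemma Dker_neg (n : ℕ) (u : ℝ) : Dker n (-u) = Dker n u := by
  simp [Dker, neg_div, div_neg]

lemma Dtilde_neg (n : ℕ) (u : ℝ) : Dtilde n (-u) = Dtilde n u := by
  simp [Dtilde, neg_div, div_neg]

lemma abs_Dker_sub_two_pi (n : ℕ) (u : ℝ) : |Dker n (u - 2 * π)| = |Dker n u| := by
  have h1 : sin ((u - 2 * π) / 2) = -sin (u / 2) := by
    rw [← sin_sub_pi]; ring_nf
  have h2 : |sin (((n : ℝ) + 1) / 2 * (u - 2 * π))| = |sin (((n : ℝ) + 1) / 2 * u)| := by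
    have : ((n : ℝ) + 1) / 2 * (u - 2 * π) = ((n : ℝ) + 1) / 2 * u - (n + 1 : ℕ) * π := by
      push_cast; ring
    rw [this, sin_sub_nat_mul_pi]
    simp [abs_mul]
  unfold Dker
  simp only [h1, neg_eq_zero]
  split_ifs with h
  · rfl
  · rw [abs_div, abs_div, h2, abs_neg]

lemma abs_div_pi_le_abs_sin_half {u : ℝ} (hu : |u| ≤ π) : |u| / π ≤ |sin (u / 2)| := by
  have h := mul_abs_le_abs_sin (x := u / 2) (by rw [abs_div, abs_two]; linarith)
  rw [abs_div, abs_two] at h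
  calc |u| / π = 2 / π * (|u| / 2) := by ring
    _ ≤ _ := h

lemma sin_half_ne_zero {u : ℝ} (hu : |u| ≤ π) (hu0 : u ≠ 0) : sin (u / 2) ≠ 0 :=
  abs_pos.1 (lt_of_lt_of_le (div_pos (abs_pos.2 hu0) pi_pos) (abs_div_pi_le_abs_sin_half hu))

lemma abs_sin_le_mul (n : ℕ) (u : ℝ) :
    |sin (((n : ℝ) + 1) / 2 * u)| ≤ ((n : ℝ) + 1) / 2 * |u| := by
  refine (abs_sin_le_abs).trans_eq ?_
  rw [abs_mul, abs_of_pos (by positivity)]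

lemma Dker_zero (n : ℕ) : Dker n 0 = n + 1 := by simp [Dker]

lemma Dtilde_zero (n : ℕ) : Dtilde n 0 = n + 1 := by simp [Dtilde]

lemma abs_Dtilde_mul_abs_le (n : ℕ) (u : ℝ) : |Dtilde n u| * |u| ≤ 2 := by
  rcases eq_or_ne u 0 with rfl | hu
  · simp
  · have hu' := abs_pos.2 hu
    rw [Dtilde, if_neg hu, abs_div, abs_div, abs_two]
    have := abs_sin_le_one (((n : ℝ) + 1) / 2 * u)
    calc _ = 2 * |sin (((n : ℝ) + 1) / 2 * u)| := by field_simp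
      _ ≤ 2 := by linarith

lemma abs_Dtilde_le (n : ℕ) (u : ℝ) : |Dtilde n u| ≤ n + 1 := by
  rcases eq_or_ne u 0 with rfl | hu
  · rw [Dtilde_zero, abs_of_pos (by positivity)]
  · have hu' := abs_pos.2 hu
    rw [Dtilde, if_neg hu, abs_div, abs_div, abs_two, div_le_iff₀ (by positivity)]
    linarith [abs_sin_le_mul n u]

lemma abs_Dker_mul_abs_le (n : ℕ) {u : ℝ} (hu : |u| ≤ π) : |Dker n u| * |u| ≤ π := by
  rcases eq_or_ne u 0 with rfl | hu0
  · simp [pi_pos.le]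
  · have hs := sin_half_ne_zero hu hu0
    have hs' := abs_pos.2 hs
    have h := abs_div_pi_le_abs_sin_half hu
    rw [div_le_iff₀ pi_pos] at h
    rw [Dker, if_neg hs, abs_div, div_mul_eq_mul_div, div_le_iff₀ hs']
    have := abs_sin_le_one (((n : ℝ) + 1) / 2 * u)
    nlinarith [abs_nonneg u]

lemma abs_Dker_le (n : ℕ) {u : ℝ} (hu : |u| ≤ π) : |Dker n u| ≤ 2 * (n + 1) := by
  have hn : (0 : ℝ) < (n : ℝ) + 1 := by positivity
  rcases eq_or_ne u 0 with rfl | hu0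
  · rw [Dker_zero, abs_of_pos hn]; linarith
  · have hs := sin_half_ne_zero hu hu0
    have hs' := abs_pos.2 hs
    have h := abs_div_pi_le_abs_sin_half hu
    rw [div_le_iff₀ pi_pos] at h
    rw [Dker, if_neg hs, abs_div, div_le_iff₀ hs']
    have h4 : |u| ≤ 4 * |sin (u / 2)| := by nlinarith [pi_le_four]
    nlinarith [abs_sin_le_mul n u]

lemma abs_Dtilde_le_peak {n : ℕ} (hn : 2 ≤ n) (u : ℝ) : |Dtilde n u| ≤ 4 * peak n u := by
  have hn2 : (2 : ℝ) ≤ n := by exact_mod_cast hn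
  rw [peak, ← div_eq_mul_inv, le_div_iff₀ (peak_denom_pos hn u), mul_add]
  have h : |Dtilde n u| * (1 / (n : ℝ)) ≤ 2 := by
    rw [mul_one_div, div_le_iff₀ (by linarith)]
    linarith [abs_Dtilde_le n u]
  linarith [abs_Dtilde_mul_abs_le n u]

lemma abs_Dker_le_peak {n : ℕ} (hn : 2 ≤ n) {u : ℝ} (hu : |u| ≤ π) :
    |Dker n u| ≤ 8 * peak n u := by
  have hn2 : (2 : ℝ) ≤ n := by exact_mod_cast hn
  rw [peak, ← div_eq_mul_inv, le_div_iff₀ (peak_denom_pos hn u), mul_add]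
  have h : |Dker n u| * (1 / (n : ℝ)) ≤ 4 := by
    rw [mul_one_div, div_le_iff₀ (by linarith)]
    linarith [abs_Dker_le n hu]
  linarith [abs_Dker_mul_abs_le n hu, pi_le_four]

lemma abs_Dker_le_two (n : ℕ) {u : ℝ} (hu : |u| ≤ π) (hu' : π / 2 ≤ |u|) :
    |Dker n u| ≤ 2 := by
  have h := abs_Dker_mul_abs_le n hu
  nlinarith [pi_pos, abs_nonneg (Dker n u)]

lemma sub_sin_le_sq {v : ℝ} (hv : 0 ≤ v) (hv' : v ≤ π / 2) : v - sin v ≤ v ^ 2 := by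
  rcases hv.eq_or_lt with rfl | hv0
  · simp
  have := sin_gt_sub_cube hv0
  nlinarith [mul_nonneg (sq_nonneg v) (by linarith [pi_le_four] : 0 ≤ 2 - v)]

lemma abs_Dker_sub_Dtilde_le (n : ℕ) {u : ℝ} (hu : |u| ≤ π) :
    |Dker n u - Dtilde n u| ≤ 2 := by
  wlog h0 : 0 ≤ u generalizing u
  · rw [← Dker_neg, ← Dtilde_neg]
    exact this (by rwa [abs_neg]) (by linarith)
  rcases eq_or_ne u 0 with rfl | hu0
  · simp [Dker_zero, Dtilde_zero]
  have hs := sin_half_ne_zero hu hu0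
  have h := abs_div_pi_le_abs_sin_half hu
  have hpos : 0 < u := lt_of_le_of_ne h0 hu0.symm
  rw [abs_of_nonneg h0] at hu h
  have hs0 : 0 ≤ sin (u / 2) :=
    sin_nonneg_of_nonneg_of_le_pi (by linarith) (by linarith)
  have hs1 : 0 < sin (u / 2) := lt_of_le_of_ne hs0 hs.symm
  rw [abs_of_nonneg hs0, div_le_iff₀ pi_pos] at h
  have hle := sub_sin_le_sq (v := u / 2) (by linarith) (by linarith)
  have hge := sin_le (x := u / 2) (by linarith)
  rw [Dker, Dtilde, if_neg hs, if_neg hu0]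
  have key : sin (((n : ℝ) + 1) / 2 * u) / sin (u / 2) - sin (((n : ℝ) + 1) / 2 * u) / (u / 2)
      = sin (((n : ℝ) + 1) / 2 * u) * ((u / 2 - sin (u / 2)) / (sin (u / 2) * (u / 2))) := by
    field_simp
  have hq : (u / 2 - sin (u / 2)) / (sin (u / 2) * (u / 2)) ≤ 2 := by
    rw [div_le_iff₀ (by positivity)]
    have : u ≤ 4 * sin (u / 2) := by nlinarith [pi_le_four]
    nlinarith
  have hq0 : 0 ≤ (u / 2 - sin (u / 2)) / (sin (u / 2) * (u / 2)) :=
    div_nonneg (by linarith) (by positivity)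
  rw [key, abs_mul, abs_of_nonneg hq0]
  have := abs_sin_le_one (((n : ℝ) + 1) / 2 * u)
  nlinarith [abs_nonneg (sin (((n : ℝ) + 1) / 2 * u))]

/-- If `a` lies in `(π, 2π]`, only one of the factors `Dker n a`, `Dker n b` can be large. -/
lemma abs_mul_sub_mul_le_of_pi_lt {n : ℕ} (hn : 2 ≤ n) {a b : ℝ} (hb : |b| ≤ π)
    (hab : |a + b| ≤ π) (ha : π < a) :
    |Dker n a * Dker n b - Dtilde n a * Dtilde n b| ≤
      20 * (peak n b + peak n (a - 2 * π)) := by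
  obtain ⟨hb1, hb2⟩ := abs_le.1 hb
  obtain ⟨hab1, hab2⟩ := abs_le.1 hab
  have ha2 : |a - 2 * π| ≤ π := abs_le.2 ⟨by linarith, by linarith⟩
  have hT : |Dtilde n a| ≤ 1 := by
    have := abs_Dtilde_mul_abs_le n a
    rw [abs_of_pos (by linarith [pi_pos] : 0 < a)] at this
    nlinarith [pi_gt_three, abs_nonneg (Dtilde n a)]
  have hTb := abs_Dtilde_le_peak hn b
  have hTT : |Dtilde n a| * |Dtilde n b| ≤ 4 * peak n b := by
    nlinarith [abs_nonneg (Dtilde n b)]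
  have hDb := abs_Dker_le_peak hn hb
  have hDa := abs_Dker_le_peak hn ha2
  rw [abs_Dker_sub_two_pi] at hDa
  have hp1 := peak_pos hn b
  have hp2 := peak_pos hn (a - 2 * π)
  have hDD : |Dker n a| * |Dker n b| ≤ 16 * (peak n b + peak n (a - 2 * π)) := by
    rcases le_or_gt a (3 * π / 2) with h | h
    · have := abs_Dker_le_two n ha2 (by rw [abs_of_nonpos (by linarith)]; linarith)
      rw [abs_Dker_sub_two_pi] at this
      nlinarith [abs_nonneg (Dker n b)]
    · have := abs_Dker_le_two n hb (by rw [abs_of_nonpos (by linarith)]; linarith)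
      nlinarith [abs_nonneg (Dker n a)]
  calc _ ≤ |Dker n a * Dker n b| + |Dtilde n a * Dtilde n b| := abs_sub _ _
    _ ≤ _ := by rw [abs_mul, abs_mul]; linarith

lemma abs_mul_sub_mul_le {n : ℕ} (hn : 2 ≤ n) {a b : ℝ} (hb : |b| ≤ π)
    (hab : |a + b| ≤ π) :
    |Dker n a * Dker n b - Dtilde n a * Dtilde n b| ≤
      20 * (peak n b + peak n a + peak n (a - 2 * π) + peak n (a + 2 * π)) := by
  have hp1 := peak_pos hn b
  have hp2 := peak_pos hn (a - 2 * π)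
  have hp3 := peak_pos hn (a + 2 * π)
  have hp4 := peak_pos hn a
  rcases le_or_gt |a| π with ha | ha
  · have h1 := abs_Dker_sub_Dtilde_le n ha
    have h2 := abs_Dker_sub_Dtilde_le n hb
    have h3 := abs_Dker_le_peak hn hb
    have h4 := abs_Dtilde_le_peak hn a
    calc |Dker n a * Dker n b - Dtilde n a * Dtilde n b|
        = |(Dker n a - Dtilde n a) * Dker n b + Dtilde n a * (Dker n b - Dtilde n b)| := by
          ring_nf
      _ ≤ |Dker n a - Dtilde n a| * |Dker n b| + |Dtilde n a| * |Dker n b - Dtilde n b| := by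
          rw [← abs_mul, ← abs_mul]; exact abs_add_le _ _
      _ ≤ 2 * (8 * peak n b) + (4 * peak n a) * 2 := by gcongr
      _ ≤ _ := by linarith
  · rcases lt_abs.1 ha with h | h
    · linarith [abs_mul_sub_mul_le_of_pi_lt hn hb hab h]
    · have := abs_mul_sub_mul_le_of_pi_lt hn (a := -a) (b := -b) (by rwa [abs_neg])
        (by rwa [← neg_add, abs_neg]) h
      rw [show -a - 2 * π = -(a + 2 * π) by ring] at this
      simp only [Dker_neg, Dtilde_neg, peak_neg] at this
      linarith

lemma measurable_Dker (n : ℕ) : Measurable (Dker n) := by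
  unfold Dker
  refine Measurable.ite ?_ measurable_const (by fun_prop)
  exact (measurableSet_singleton (0 : ℝ)).preimage (by fun_prop : Measurable fun x => sin (x / 2))

lemma measurable_Dtilde (n : ℕ) : Measurable (Dtilde n) := by
  unfold Dtilde
  exact Measurable.ite (measurableSet_singleton (0 : ℝ)) measurable_const (by fun_prop)

lemma integral_peak_zero {n : ℕ} (hn : 2 ≤ n) {R : ℝ} (hR : 0 ≤ R) :
    ∫ u in (0 : ℝ)..R, peak n u = log (1 + n * R) := by
  have hn0 : (0 : ℝ) < n := by exact_mod_cast (by omega : 0 < n)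
  have h : ∀ u ∈ Set.uIcc 0 R, peak n u = (1 / (n : ℝ) + u)⁻¹ := by
    intro u hu
    rw [Set.uIcc_of_le hR] at hu
    rw [peak, abs_of_nonneg hu.1]
  rw [intervalIntegral.integral_congr h,
    intervalIntegral.integral_comp_add_left (fun u => u⁻¹),
    integral_inv_of_pos (by positivity) (by positivity)]
  congr 1
  field_simp
  simp

lemma integral_peak_symm {n : ℕ} (hn : 2 ≤ n) {R : ℝ} (hR : 0 ≤ R) :
    ∫ u in (-R)..R, peak n u = 2 * log (1 + n * R) := by
  have hi (a b : ℝ) := (continuous_peak hn).intervalIntegrable (μ := volume) a b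
  have h : ∫ u in (-R)..0, peak n u = ∫ u in (0 : ℝ)..R, peak n u := by
    have := intervalIntegral.integral_comp_neg (a := 0) (b := R) (peak n)
    simpa [peak_neg] using this.symm
  rw [← intervalIntegral.integral_add_adjacent_intervals (hi (-R) 0) (hi 0 R), h,
    integral_peak_zero hn hR]
  ring

lemma integral_peak_add_le {n : ℕ} (hn : 2 ≤ n) {c : ℝ} (hc : |c| ≤ 3 * π) :
    ∫ x in (-π)..π, peak n (x + c) ≤ 10 * log n := by
  obtain ⟨hc1, hc2⟩ := abs_le.1 hc
  have hn2 : (2 : ℝ) ≤ n := by exact_mod_cast hn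
  have hlog : log (1 + n * (4 * π)) ≤ 5 * log n := by
    have h5 : (5 : ℝ) * log n = log ((n : ℝ) ^ 5) := by rw [log_pow]; norm_num
    rw [h5]
    apply log_le_log (by positivity)
    have h4 : (2 : ℝ) ^ 4 ≤ (n : ℝ) ^ 4 := by gcongr
    nlinarith [pi_lt_d2]
  calc ∫ x in (-π)..π, peak n (x + c) = ∫ u in (-π + c)..(π + c), peak n u :=
        intervalIntegral.integral_comp_add_right (peak n) c
    _ ≤ ∫ u in (-(4 * π))..(4 * π), peak n u :=
        intervalIntegral.integral_mono_interval (by linarith) (by linarith [pi_pos])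
          (by linarith) (Filter.Eventually.of_forall fun u => (peak_pos hn u).le)
          ((continuous_peak hn).intervalIntegrable _ _)
    _ = 2 * log (1 + n * (4 * π)) := integral_peak_symm hn (by positivity)
    _ ≤ 10 * log n := by linarith

theorem stmt0 :
    ∃ C : ℝ, 0 < C ∧ ∀ n : ℕ, 2 ≤ n → ∀ y : ℝ, |y| ≤ π →
      |(∫ x in (-π)..π, Dker n (x + y) * Dker n (-x)) -
        (∫ x in (-π)..π, Dtilde n (x + y) * Dtilde n (-x))| ≤ C * Real.log n := by
  refine ⟨800, by norm_num, fun n hn y hy => ?_⟩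
  obtain ⟨hy1, hy2⟩ := abs_le.1 hy
  have hpi := pi_pos
  have hpi' : -π ≤ π := by linarith
  have hp (c : ℝ) : IntervalIntegrable (fun x => peak n (x + c)) volume (-π) π :=
    ((continuous_peak hn).comp (continuous_add_const c)).intervalIntegrable _ _
  have hpc (c : ℝ) (hc : |c| ≤ 3 * π) := integral_peak_add_le hn hc
  have hDm : Measurable fun x => Dker n (x + y) * Dker n (-x) :=
    ((measurable_Dker n).comp (by fun_prop)).mul ((measurable_Dker n).comp (by fun_prop))
  have hTm : Measurable fun x => Dtilde n (x + y) * Dtilde n (-x) :=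
    ((measurable_Dtilde n).comp (by fun_prop)).mul ((measurable_Dtilde n).comp (by fun_prop))
  set G : ℝ → ℝ := fun x => 20 * (peak n (x + 0) + peak n (x + y) +
    peak n (x + (y - 2 * π)) + peak n (x + (y + 2 * π))) with hG
  have hGi : IntervalIntegrable G volume (-π) π :=
    ((((hp _).add (hp _)).add (hp _)).add (hp _)).const_mul 20
  have hbound : ∀ x ∈ Set.Ioc (-π) π, ‖Dker n (x + y) * Dker n (-x) -
      Dtilde n (x + y) * Dtilde n (-x)‖ ≤ G x := by
    intro x hx
    have := abs_mul_sub_mul_le hn (a := x + y) (b := -x)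
      (by rw [abs_neg]; exact abs_le.2 ⟨hx.1.le, hx.2⟩) (by simpa using hy)
    rw [peak_neg, add_sub_assoc, add_assoc x y (2 * π)] at this
    simpa only [hG, add_zero, norm_eq_abs] using this
  have hTi : IntervalIntegrable (fun x => Dtilde n (x + y) * Dtilde n (-x)) volume (-π) π := by
    refine (intervalIntegrable_const (c := ((n : ℝ) + 1) * (n + 1))).mono_fun
      hTm.aestronglyMeasurable (Filter.Eventually.of_forall fun x => ?_)
    simp only [norm_eq_abs, abs_mul]
    rw [abs_of_pos (by positivity : (0 : ℝ) < n + 1)]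
    gcongr <;> exact abs_Dtilde_le n _
  have hdi : IntervalIntegrable (fun x => Dker n (x + y) * Dker n (-x) -
      Dtilde n (x + y) * Dtilde n (-x)) volume (-π) π := by
    refine hGi.mono_fun' (hDm.sub hTm).aestronglyMeasurable ?_
    rw [Set.uIoc_of_le hpi']
    exact (ae_restrict_iff' measurableSet_Ioc).2 (Filter.Eventually.of_forall hbound)
  have hDi : IntervalIntegrable (fun x => Dker n (x + y) * Dker n (-x)) volume (-π) π := by
    simpa using hdi.add hTi
  rw [← intervalIntegral.integral_sub hDi hTi, ← norm_eq_abs]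
  refine (intervalIntegral.norm_integral_le_of_norm_le hpi'
    (Filter.Eventually.of_forall hbound) hGi).trans ?_
  rw [hG, intervalIntegral.integral_const_mul,
    intervalIntegral.integral_add (((hp _).add (hp _)).add (hp _)) (hp _),
    intervalIntegral.integral_add ((hp _).add (hp _)) (hp _),
    intervalIntegral.integral_add (hp _) (hp _)]
  linarith [hpc 0 (by rw [abs_zero]; positivity), hpc y (by linarith),
    hpc (y - 2 * π) (abs_le.2 ⟨by linarith, by linarith⟩),
    hpc (y + 2 * π) (abs_le.2 ⟨by linarith, by linarith⟩)]
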